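/- Fix c ≥ 1, ε with 0 < ε < 1/c, and ℓ ≥ 1, and let n be a function from m to the positive integers with n(m)^{ℓ + 1/c − ε} = Ω(m). There is an m_0 such that for all m ≥ m_0 the following holds: for every injective function f from {1,…,n}^m into finite binary strings, if S is chosen uniformly at random from {1,…,n}^m, then Pr[ |f(S)| > (c · H_ℓ(S) + (ε/3) log n) m ] ≥ 1 − 2/n^{εm/3} − n^ℓ / 2^{n^{ε/3} − ℓ}. (Consequently, with this probability the Kolmogorov complexity of S exceeds (c · H_ℓ(S) + (ε/3) log n) m.) -/

import Mathlib

open scoped BigOperators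

/-- `follow α S` is the string `S_α` whose `i`th character is the character immediately
following the `i`th occurrence of `α` in `S` (when the empty string `α = []`,
this is `S` itself). -/
def follow {A : Type*} [DecidableEq A] (α S : List A) : List A :=
  (List.range S.length).filterMap fun i =>
    if (S.drop i).take α.length = α then (S.drop (i + α.length)).head? else none

/-- the number `#_α(S)` of occurrences of a non-empty string `α` as a substring of `S` -/
def countOcc {A : Type*} [DecidableEq A] (α S : List A) : ℕ :=
  ((List.range S.length).filter fun i => (S.drop i).take α.length = α).length

/-- the zeroth-order empirical entropy `H_0(S) = Σ_{a∈S} (#_a(S)/m) log₂(m/#_a(S))` -/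
noncomputable def H0 {A : Type*} [DecidableEq A] (S : List A) : ℝ :=
  ∑ a ∈ S.toFinset, ((S.count a : ℝ) / S.length) * Real.logb 2 ((S.length : ℝ) / (S.count a))

/-- the `ℓ`th-order empirical entropy of a string over the alphabet `Fin n`:
`H_ℓ(S) = (1/m) Σ_{|α| = ℓ} |S_α| H_0(S_α)` for `ℓ ≥ 1`, and `H_0(S)` for `ℓ = 0`. -/
noncomputable def empEnt (n ℓ : ℕ) (S : List (Fin n)) : ℝ :=
  if ℓ = 0 then H0 S
  else (S.length : ℝ)⁻¹ *
    ∑ α : Fin ℓ → Fin n, ((follow (List.ofFn α) S).length : ℝ) * H0 (follow (List.ofFn α) S)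

/-- Shannon entropy (base 2) of a distribution on `Fin n` -/
noncomputable def entropy {n : ℕ} (P : Fin n → ℝ) : ℝ :=
  ∑ a, P a * Real.logb 2 (1 / P a)

/-- relative entropy (Kullback-Leibler distance, base 2) `D(P‖Q)` -/
noncomputable def relEnt {n : ℕ} (P Q : Fin n → ℝ) : ℝ :=
  ∑ a, P a * Real.logb 2 (P a / Q a)

/-- the normalized distribution of the characters of a string -/
noncomputable def normDist {n : ℕ} (L : List (Fin n)) : Fin n → ℝ :=
  fun a => (L.count a : ℝ) / L.length

/-- An `ℓ`th-order Markov process over the alphabet `Fin n` (which emits the first `ℓ`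
characters with probability 1), specified by a probability distribution `q α` over the
alphabet for each context `α` of length `ℓ`. -/
structure MarkovProcess (n ℓ : ℕ) where
  q : List (Fin n) → Fin n → ℝ
  nonneg : ∀ α a, 0 ≤ q α a
  sum_one : ∀ α : List (Fin n), α.length = ℓ → ∑ a, q α a = 1

/-- `Pr[Q emits S] = ∏_{i=ℓ+1}^m q_{s_{i−ℓ}⋯s_{i−1}, s_i}` for an `ℓ`th-order Markov
process that emits `s_1⋯s_ℓ` with probability 1. -/
noncomputable def emitProb {n : ℕ} (ℓ : ℕ) (Q : MarkovProcess n ℓ) (S : List (Fin n)) : ℝ :=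
  ∏ i : Fin S.length,
    if ℓ ≤ (i : ℕ) then Q.q ((S.drop ((i : ℕ) - ℓ)).take ℓ) (S.get i) else 1

/-- the indicator variable which is 1 iff `α = s_{i+1}⋯s_{i+ℓ}` occurs (0-indexed) at
position `i` in `S` and the next character `s_{i+ℓ+1}` does not occur in `α` -/
def Xvar {n m : ℕ} (ℓ : ℕ) (α : Fin ℓ → Fin n) (i : ℕ) (S : Fin m → Fin n) : ℕ :=
  if h : i + ℓ < m then
    if (∀ j : Fin ℓ, S ⟨i + j.1, by have := j.2; omega⟩ = α j) ∧
        (∀ j : Fin ℓ, α j ≠ S ⟨i + ℓ, h⟩) then 1 else 0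
  else 0

/-- lists of booleans of length at most `N` -/
lemma card_short {X : Type*} [Fintype X] (f : X → List Bool) (hf : Function.Injective f)
    (x : ℝ) :
    ((Finset.univ.filter fun S => ((f S).length : ℝ) ≤ x).card : ℝ) ≤ 2 * (2 : ℝ) ^ x := by
  classical
  rcases lt_or_ge x 0 with hx | hx
  · rw [Finset.filter_false_of_mem]
    · simp only [Finset.card_empty, Nat.cast_zero]; positivity
    · intro S _ h
      have : (0 : ℝ) ≤ ((f S).length : ℝ) := Nat.cast_nonneg _
      linarith
  set N := ⌊x⌋₊ with hN
  have h1 : (Finset.univ.filter fun S => ((f S).length : ℝ) ≤ x).card ≤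
      ((Finset.range (N + 1)).biUnion fun j =>
        (Finset.univ : Finset (Fin j → Bool)).image List.ofFn).card := by
    apply Finset.card_le_card_of_injOn f _ hf.injOn
    intro S hS
    simp only [Finset.coe_filter, Finset.mem_univ, true_and, Set.mem_ofPred_eq] at hS
    have : (f S).length ≤ N := Nat.le_floor hS
    simp only [Finset.coe_biUnion, Set.mem_iUnion, Finset.mem_coe, Finset.mem_range,
      Finset.mem_image, Finset.mem_univ, true_and]
    exact ⟨(f S).length, by omega, (f S).get, List.ofFn_get _⟩
  have h2 : ((Finset.range (N + 1)).biUnion fun j =>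
        (Finset.univ : Finset (Fin j → Bool)).image List.ofFn).card ≤ 2 ^ (N + 1) := by
    refine Finset.card_biUnion_le.trans ?_
    refine (Finset.sum_le_sum (g := fun j => 2 ^ j) fun j _ => ?_).trans ?_
    · refine Finset.card_image_le.trans ?_
      simp
    · exact (Nat.geomSum_lt le_rfl (by simp)).le
  have h3 : ((Finset.univ.filter fun S => ((f S).length : ℝ) ≤ x).card : ℝ) ≤ 2 ^ (N + 1) := by
    exact_mod_cast h1.trans h2
  refine h3.trans ?_
  rw [pow_succ, mul_comm]
  gcongr
  rw [← Real.rpow_natCast]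
  exact Real.rpow_le_rpow_of_exponent_le one_le_two (Nat.floor_le hx)

/-- positions of occurrences of `α` in `S` -/
def occ {n m ℓ : ℕ} (α : Fin ℓ → Fin n) (S : Fin m → Fin n) : Finset ℕ :=
  (Finset.range m).filter fun i => ((List.ofFn S).drop i).take ℓ = List.ofFn α

lemma occ_spec {n m ℓ : ℕ} (α : Fin ℓ → Fin n) (S : Fin m → Fin n) (i : ℕ)
    (hi : i ∈ occ α S) : ∃ h : i + ℓ ≤ m, ∀ j (hj : j < ℓ), S ⟨i + j, by omega⟩ = α ⟨j, hj⟩ := by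
  simp only [occ, Finset.mem_filter, Finset.mem_range] at hi
  obtain ⟨him, h⟩ := hi
  have hl := congrArg List.length h
  simp only [List.length_take, List.length_drop, List.length_ofFn] at hl
  refine ⟨by omega, fun j hj => ?_⟩
  have := List.getElem_of_eq h (i := j) (by simp; omega)
  simpa using this

lemma card_fixed {n m ℓ : ℕ} (α : Fin ℓ → Fin n) (T : Finset ℕ) (r : ℕ)
    (hT : ∀ t ∈ T, t % ℓ = r) :
    (Finset.univ.filter fun S : Fin m → Fin n => T ⊆ occ α S).card * n ^ (ℓ * T.card) ≤ n ^ m := by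
  classical
  rcases (Finset.univ.filter fun S : Fin m → Fin n => T ⊆ occ α S).eq_empty_or_nonempty with h | h
  · rw [h]; simp
  obtain ⟨S₀, hS₀⟩ := h
  simp only [Finset.mem_filter, Finset.mem_univ, true_and] at hS₀
  have hdisj : (T : Set ℕ).PairwiseDisjoint fun t => Finset.Ico t (t + ℓ) := by
    intro s hs t ht hst
    rw [Function.onFun, Finset.disjoint_left]
    intro x hx hx'
    simp only [Finset.mem_Ico] at hx hx'
    have e1 := hT s hs
    have e2 := hT t ht
    have d1 := Nat.div_add_mod s ℓ
    have d2 := Nat.div_add_mod t ℓ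
    apply hst
    have : s / ℓ = t / ℓ := by
      rcases lt_trichotomy (s / ℓ) (t / ℓ) with hh | hh | hh
      · have := Nat.mul_le_mul_left ℓ (Nat.succ_le_of_lt hh)
        rw [Nat.succ_eq_add_one, Nat.mul_add] at this
        omega
      · exact hh
      · have := Nat.mul_le_mul_left ℓ (Nat.succ_le_of_lt hh)
        rw [Nat.succ_eq_add_one, Nat.mul_add] at this
        omega
    rw [this] at d1
    omega
  set U' := T.biUnion fun t => Finset.Ico t (t + ℓ) with hU'
  have hcU' : U'.card = ℓ * T.card := by
    rw [hU', Finset.card_biUnion hdisj]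
    simp [mul_comm]
  have hlt : ∀ x ∈ U', x < m := by
    intro x hx
    simp only [hU', Finset.mem_biUnion, Finset.mem_Ico] at hx
    obtain ⟨t, ht, h1, h2⟩ := hx
    obtain ⟨h, -⟩ := occ_spec α S₀ t (hS₀ ht)
    omega
  set U := U'.attachFin hlt with hU
  have hcU : U.card = ℓ * T.card := by rw [hU, Finset.card_attachFin, hcU']
  have hinj : (Finset.univ.filter fun S : Fin m → Fin n => T ⊆ occ α S).card ≤
      (Finset.univ : Finset ({i : Fin m // i ∉ U} → Fin n)).card := by
    apply Finset.card_le_card_of_injOn (fun S i => S i.1) (by intro _ _; simp)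
    intro S hS S' hS' hSS
    simp only [Finset.coe_filter, Finset.mem_univ, true_and, Set.mem_ofPred_eq] at hS hS'
    funext i
    by_cases hi : i ∈ U
    · rw [hU, Finset.mem_attachFin, hU', Finset.mem_biUnion] at hi
      obtain ⟨t, ht, hti⟩ := hi
      rw [Finset.mem_Ico] at hti
      obtain ⟨h, h1⟩ := occ_spec α S t (hS ht)
      obtain ⟨h', h1'⟩ := occ_spec α S' t (hS' ht)
      have e := h1 (i - t) (by omega)
      have e' := h1' (i - t) (by omega)
      have hi' : (⟨t + (i - t), by omega⟩ : Fin m) = i := by ext; simp; omega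
      rw [hi'] at e e'
      rw [e, e']
    · exact congrFun hSS ⟨i, hi⟩
  have hcard : Fintype.card {i : Fin m // i ∉ U} = m - ℓ * T.card := by
    rw [Fintype.card_subtype_compl, Fintype.card_fin]
    simp [hcU]
  rw [Finset.card_univ, Fintype.card_fun, hcard, Fintype.card_fin] at hinj
  have hle : ℓ * T.card ≤ m := by
    rw [← hcU]; simpa using Finset.card_le_univ U
  calc _ ≤ n ^ (m - ℓ * T.card) * n ^ (ℓ * T.card) := Nat.mul_le_mul_right _ hinj
    _ = n ^ m := by rw [← pow_add, Nat.sub_add_cancel hle]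

lemma card_many {n m ℓ : ℕ} (hℓ : 1 ≤ ℓ) (α : Fin ℓ → Fin n) (k : ℕ) :
    (Finset.univ.filter fun S : Fin m → Fin n => ℓ * k ≤ (occ α S).card).card * n ^ (ℓ * k)
      ≤ m.choose k * n ^ m := by
  classical
  set F := (Finset.powersetCard k (Finset.range m)).filter
    (fun T => ∃ r, ∀ t ∈ T, t % ℓ = r) with hF
  have hsub : (Finset.univ.filter fun S : Fin m → Fin n => ℓ * k ≤ (occ α S).card) ⊆
      F.biUnion fun T => Finset.univ.filter fun S : Fin m → Fin n => T ⊆ occ α S := by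
    intro S hS
    simp only [Finset.mem_filter, Finset.mem_univ, true_and] at hS
    obtain ⟨r, -, hr⟩ := Finset.exists_le_card_fiber_of_mul_le_card_of_maps_to
      (s := occ α S) (t := Finset.range ℓ) (f := fun i => i % ℓ) (n := k)
      (fun a _ => Finset.mem_range.2 (Nat.mod_lt _ hℓ)) ⟨0, Finset.mem_range.2 hℓ⟩ (by simpa using hS)
    obtain ⟨T, hT, hTk⟩ := Finset.exists_subset_card_eq hr
    simp only [Finset.mem_biUnion, hF, Finset.mem_filter, Finset.mem_univ, true_and,
      Finset.mem_powersetCard]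
    have hTo : T ⊆ occ α S := fun t ht => (Finset.mem_filter.1 (hT ht)).1
    exact ⟨T, ⟨⟨fun t ht => (Finset.mem_filter.1 (hTo ht)).1, hTk⟩, r,
      fun t ht => (Finset.mem_filter.1 (hT ht)).2⟩, hTo⟩
  calc _ ≤ (∑ T ∈ F, (Finset.univ.filter fun S : Fin m → Fin n => T ⊆ occ α S).card)
          * n ^ (ℓ * k) :=
        Nat.mul_le_mul_right _ ((Finset.card_le_card hsub).trans Finset.card_biUnion_le)
    _ ≤ ∑ T ∈ F, n ^ m := by
        rw [Finset.sum_mul]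
        apply Finset.sum_le_sum
        intro T hT
        simp only [hF, Finset.mem_filter, Finset.mem_powersetCard] at hT
        obtain ⟨⟨-, hk⟩, r, hr⟩ := hT
        rw [← hk]
        exact card_fixed α T r hr
    _ ≤ m.choose k * n ^ m := by
        rw [Finset.sum_const, smul_eq_mul]
        apply Nat.mul_le_mul_right
        refine (Finset.card_filter_le _ _).trans ?_
        simp

lemma follow_length_le {n m ℓ : ℕ} (α : Fin ℓ → Fin n) (S : Fin m → Fin n) :
    (follow (List.ofFn α) (List.ofFn S)).length ≤ (occ α S).card := by
  have hgen : ∀ (p : ℕ → Prop) [DecidablePred p] (g : ℕ → Option (Fin n)) (L : List ℕ),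
      (L.filterMap fun i => if p i then g i else none).length ≤ (L.filter (fun i => p i)).length := by
    intro p _ g L
    induction L with
    | nil => simp
    | cons a L ih =>
      by_cases h : p a
      · cases hg : g a <;> simp [h, hg] <;> omega
      · simp [h, ih]
  have := hgen (fun i => ((List.ofFn S).drop i).take ℓ = List.ofFn α)
    (fun i => ((List.ofFn S).drop (i + ℓ)).head?) (List.range m)
  simp only [follow, List.length_ofFn]
  refine this.trans (le_of_eq ?_)
  simp only [occ, Finset.card_def, Finset.filter_val, Finset.range_val, Multiset.range,
    Multiset.filter_coe, Multiset.coe_card]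

lemma sum_occ_le {n m ℓ : ℕ} (S : Fin m → Fin n) :
    ∑ α : Fin ℓ → Fin n, (occ α S).card ≤ m := by
  classical
  simp only [occ, Finset.card_filter]
  rw [Finset.sum_comm]
  calc _ ≤ ∑ i ∈ Finset.range m, 1 := by
        apply Finset.sum_le_sum
        intro i _
        rw [← Finset.card_filter, Finset.card_le_one]
        intro a ha b hb
        simp only [Finset.mem_filter, Finset.mem_univ, true_and] at ha hb
        exact List.ofFn_injective (ha.symm.trans hb)
    _ = m := by simp

lemma H0_le {A : Type*} [DecidableEq A] (L : List A) :
    (L.length : ℝ) * H0 L ≤ L.length * Real.logb 2 L.length := by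
  rcases eq_or_ne L [] with rfl | hL
  · simp
  have hlen : (0 : ℝ) < L.length := by exact_mod_cast List.length_pos_iff.2 hL
  gcongr
  unfold H0
  calc _ ≤ ∑ a ∈ L.toFinset, ((L.count a : ℝ) / L.length) * Real.logb 2 (L.length : ℝ) := by
        apply Finset.sum_le_sum
        intro a ha
        have hc : 1 ≤ (L.count a : ℝ) := by
          exact_mod_cast List.count_pos_iff.2 (List.mem_toFinset.1 ha)
        gcongr
        · norm_num
        · exact div_le_self hlen.le hc
    _ = Real.logb 2 L.length := by
        rw [← Finset.sum_mul, ← Finset.sum_div, ← Nat.cast_sum, List.sum_toFinset_count_eq_length,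
          div_self hlen.ne', one_mul]

lemma empEnt_le {n m ℓ : ℕ} (hℓ : 1 ≤ ℓ) (hm : 0 < m) (S : Fin m → Fin n) (R : ℝ) (hR : 1 ≤ R)
    (h : ∀ α : Fin ℓ → Fin n, ((occ α S).card : ℝ) ≤ R) :
    empEnt n ℓ (List.ofFn S) ≤ Real.logb 2 R := by
  have hlog : 0 ≤ Real.logb 2 R := Real.logb_nonneg one_lt_two hR
  have hm' : (0 : ℝ) < m := by exact_mod_cast hm
  unfold empEnt
  rw [if_neg (by omega), List.length_ofFn, inv_mul_le_iff₀ hm']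
  calc _ ≤ ∑ α : Fin ℓ → Fin n, ((occ α S).card : ℝ) * Real.logb 2 R := by
        apply Finset.sum_le_sum
        intro α _
        refine (H0_le _).trans ?_
        have hle : ((follow (List.ofFn α) (List.ofFn S)).length : ℝ) ≤ (occ α S).card := by
          exact_mod_cast follow_length_le α S
        rcases Nat.eq_zero_or_pos (follow (List.ofFn α) (List.ofFn S)).length with h0 | h0
        · rw [h0]; simp only [Nat.cast_zero, zero_mul]; positivity
        · have h0' : (0 : ℝ) < (follow (List.ofFn α) (List.ofFn S)).length := by exact_mod_cast h0
          have : Real.logb 2 (follow (List.ofFn α) (List.ofFn S)).length ≤ Real.logb 2 R :=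
            Real.logb_le_logb_of_le one_lt_two h0' (hle.trans (h α))
          calc _ ≤ ((follow (List.ofFn α) (List.ofFn S)).length : ℝ) * Real.logb 2 R := by gcongr
            _ ≤ _ := by gcongr
    _ ≤ m * Real.logb 2 R := by
        rw [← Finset.sum_mul]
        gcongr
        exact_mod_cast sum_occ_le (ℓ := ℓ) S

lemma tail_bound {n m ℓ : ℕ} (hn : 0 < n) (hℓ : 1 ≤ ℓ) (α : Fin ℓ → Fin n) (R : ℝ)
    (hR : 2 * ℓ ≤ R)
    (hmR : 2 * ℓ * Real.exp 1 * m * 2 ^ (2 * ℓ) ≤ R * (n : ℝ) ^ ℓ) :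
    ((Finset.univ.filter fun S : Fin m → Fin n => R < ((occ α S).card : ℝ)).card : ℝ) ≤
      (n : ℝ) ^ m / (2 : ℝ) ^ R := by
  have hℓ' : (1 : ℝ) ≤ ℓ := by exact_mod_cast hℓ
  have hn' : (0 : ℝ) < n := by exact_mod_cast hn
  set k := ⌊R / ℓ⌋₊ with hk
  have hk1 : (k : ℝ) * ℓ ≤ R := by
    have := Nat.floor_le (a := R / ℓ) (div_nonneg (by linarith) (by linarith))
    rwa [← hk, le_div_iff₀ (by linarith)] at this
  have hk2 : R ≤ 2 * ℓ * k := by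
    have := Nat.lt_floor_add_one (R / ℓ)
    rw [← hk, div_lt_iff₀ (by linarith)] at this
    nlinarith
  have hkpos : (0 : ℝ) < k := by
    by_contra hcon
    have : (k : ℝ) ≤ 0 := not_lt.1 hcon
    nlinarith
  set B := (Finset.univ.filter fun S : Fin m → Fin n => R < ((occ α S).card : ℝ)).card with hB
  have h1 : B ≤ (Finset.univ.filter fun S : Fin m → Fin n => ℓ * k ≤ (occ α S).card).card := by
    apply Finset.card_le_card
    intro S hS
    simp only [Finset.mem_filter, Finset.mem_univ, true_and] at hS ⊢
    have : ((ℓ * k : ℕ) : ℝ) ≤ (occ α S).card := by push_cast; linarith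
    exact_mod_cast this
  have h2 : (B : ℝ) * (n : ℝ) ^ (ℓ * k) ≤ (m.choose k : ℝ) * (n : ℝ) ^ m := by
    exact_mod_cast (Nat.mul_le_mul_right _ h1).trans (card_many hℓ α k)
  have h3 : (m.choose k : ℝ) ≤ (m : ℝ) ^ k / (k.factorial : ℝ) := Nat.choose_le_pow_div k m
  have h4 : (k : ℝ) ^ k / (k.factorial : ℝ) ≤ Real.exp k :=
    Real.pow_div_factorial_le_exp _ hkpos.le k
  have hexp : Real.exp k = Real.exp 1 ^ k := by rw [← Real.exp_nat_mul, mul_one]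
  have hfac : (0 : ℝ) < k.factorial := by exact_mod_cast Nat.factorial_pos k
  -- choose * k^k ≤ (m e)^k
  have h5 : (m.choose k : ℝ) * (k : ℝ) ^ k ≤ (Real.exp 1 * m) ^ k := by
    calc _ ≤ (m : ℝ) ^ k / (k.factorial : ℝ) * (k : ℝ) ^ k := by gcongr
      _ = (m : ℝ) ^ k * ((k : ℝ) ^ k / (k.factorial : ℝ)) := by ring
      _ ≤ (m : ℝ) ^ k * Real.exp k := by gcongr
      _ = _ := by rw [hexp, mul_pow]; ring
  have h6 : Real.exp 1 * m * 2 ^ (2 * ℓ) ≤ k * (n : ℝ) ^ ℓ := by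
    have : R * (n : ℝ) ^ ℓ ≤ 2 * ℓ * k * (n : ℝ) ^ ℓ := by gcongr
    have h7 := hmR.trans this
    have : (0 : ℝ) < 2 * ℓ := by linarith
    refine le_of_mul_le_mul_left ?_ this
    linarith
  have h7 : (m.choose k : ℝ) * (2 : ℝ) ^ (2 * ℓ * k) ≤ (n : ℝ) ^ (ℓ * k) := by
    have hkk : (0 : ℝ) < (k : ℝ) ^ k := by positivity
    refine le_of_mul_le_mul_left ?_ hkk
    calc _ = (m.choose k : ℝ) * (k : ℝ) ^ k * ((2 : ℝ) ^ (2 * ℓ)) ^ k := by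
          rw [pow_mul 2 (2 * ℓ) k]; ring
      _ ≤ (Real.exp 1 * m) ^ k * ((2 : ℝ) ^ (2 * ℓ)) ^ k := by gcongr
      _ = (Real.exp 1 * m * 2 ^ (2 * ℓ)) ^ k := (mul_pow _ _ _).symm
      _ ≤ (k * (n : ℝ) ^ ℓ) ^ k := by gcongr
      _ = _ := by rw [mul_pow, pow_mul]
  have h8 : (2 : ℝ) ^ R ≤ (2 : ℝ) ^ (2 * ℓ * k) := by
    rw [← Real.rpow_natCast]
    apply Real.rpow_le_rpow_of_exponent_le one_le_two
    push_cast
    exact hk2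
  rw [le_div_iff₀ (by positivity)]
  have hnk : (0 : ℝ) < (n : ℝ) ^ (ℓ * k) := by positivity
  refine le_of_mul_le_mul_right ?_ hnk
  calc (B : ℝ) * 2 ^ R * (n : ℝ) ^ (ℓ * k) = (B : ℝ) * (n : ℝ) ^ (ℓ * k) * 2 ^ R := by ring
    _ ≤ (m.choose k : ℝ) * (n : ℝ) ^ m * 2 ^ (2 * ℓ * k) := by gcongr
    _ = (n : ℝ) ^ m * ((m.choose k : ℝ) * (2 : ℝ) ^ (2 * ℓ * k)) := by ring
    _ ≤ _ := by gcongr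

/-- fix `c ≥ 1`, `0 < ε < 1/c`, `ℓ ≥ 1`, and `n(m)` with
`n(m)^{ℓ+1/c−ε} = Ω(m)`. For all sufficiently large `m` and every injective encoding `f`
of the length-`m` strings over `{1,…,n}` into binary strings, for a uniformly random
string `S`, `Pr[|f(S)| > (c H_ℓ(S) + (ε/3) log n) m] ≥ 1 − 2/n^{εm/3} − n^ℓ/2^{n^{ε/3}−ℓ}`. -/
theorem statement11 (c ε : ℝ) (hc : 1 ≤ c) (hε : 0 < ε) (hεc : ε < 1 / c)
    (ℓ : ℕ) (hℓ : 1 ≤ ℓ) (n : ℕ → ℕ) (hn : ∀ m, 0 < n m)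
    (hΩ : ∃ C : ℝ, 0 < C ∧ ∃ m₁ : ℕ, ∀ m ≥ m₁,
      C * m ≤ (n m : ℝ) ^ ((ℓ : ℝ) + 1 / c - ε)) :
    ∃ m₀ : ℕ, ∀ m ≥ m₀, ∀ f : (Fin m → Fin (n m)) → List Bool, Function.Injective f →
      1 - 2 / (n m : ℝ) ^ (ε * m / 3) -
          (n m : ℝ) ^ ℓ / (2 : ℝ) ^ ((n m : ℝ) ^ (ε / 3) - ℓ) ≤
        (Nat.card {S : Fin m → Fin (n m) //
            (c * empEnt (n m) ℓ (List.ofFn S) + ε / 3 * Real.logb 2 (n m)) * m <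
              ((f S).length : ℝ)} : ℝ) / (n m : ℝ) ^ m := by
  classical
  obtain ⟨C, hC, m₁, hΩ⟩ := hΩ
  have hc0 : 0 < c := by linarith
  have hcε : c * ε < 1 := by rw [lt_div_iff₀ hc0] at hεc; linarith
  have hE : 0 < (ℓ : ℝ) + 1 / c - ε := by
    have : (0 : ℝ) ≤ ℓ := Nat.cast_nonneg _
    linarith
  have htend : Filter.Tendsto n Filter.atTop Filter.atTop := by
    rw [Filter.tendsto_atTop]
    intro N
    filter_upwards [Filter.eventually_ge_atTop m₁,
      (tendsto_natCast_atTop_atTop (R := ℝ)).eventually_gt_atTop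
        ((N : ℝ) ^ ((ℓ : ℝ) + 1 / c - ε) / C)] with m hm1 hm2
    by_contra hcon
    have h1 : (n m : ℝ) ≤ N := by exact_mod_cast (not_le.1 hcon).le
    have h2 := Real.rpow_le_rpow (Nat.cast_nonneg _) h1 hE.le
    have h3 := hΩ m hm1
    rw [div_lt_iff₀ hC] at hm2
    linarith
  have htendR : Filter.Tendsto (fun m => (n m : ℝ)) Filter.atTop Filter.atTop :=
    tendsto_natCast_atTop_atTop.comp htend
  have hd : 0 < 1 / c - 2 * ε / 3 := by linarith
  have ev1 := ((tendsto_rpow_atTop hd).comp htendR).eventually_ge_atTop (2 * (ℓ : ℝ))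
  have ev2 := ((tendsto_rpow_atTop (show 0 < ε / 3 by linarith)).comp htendR).eventually_ge_atTop
    (2 * ℓ * Real.exp 1 * 2 ^ (2 * ℓ) / C)
  obtain ⟨m₀, hm₀⟩ := Filter.eventually_atTop.1
    (ev1.and (ev2.and ((Filter.eventually_ge_atTop m₁).and (Filter.eventually_gt_atTop 0))))
  refine ⟨m₀, fun m hm f hf => ?_⟩
  obtain ⟨h1, h2, hm1, hmpos⟩ := hm₀ m hm
  have hnpos := hn m
  have hCm := hΩ m hm1
  simp only [Function.comp] at h1 h2
  generalize n m = N at *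
  have hN1 : (1 : ℝ) ≤ N := by exact_mod_cast hnpos
  have hN0 : (0 : ℝ) < N := by linarith
  have hm' : (0 : ℝ) < m := by exact_mod_cast hmpos
  have hℓ' : (1 : ℝ) ≤ ℓ := by exact_mod_cast hℓ
  have hlogN : 0 ≤ Real.logb 2 N := Real.logb_nonneg one_lt_two hN1
  set R : ℝ := (N : ℝ) ^ (1 / c - 2 * ε / 3) with hRdef
  have hmR : 2 * ℓ * Real.exp 1 * m * 2 ^ (2 * ℓ) ≤ R * (N : ℝ) ^ ℓ := by
    have hK : 2 * ℓ * Real.exp 1 * 2 ^ (2 * ℓ) ≤ (N : ℝ) ^ (ε / 3) * C := by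
      rwa [div_le_iff₀ hC] at h2
    calc _ = (2 * ℓ * Real.exp 1 * 2 ^ (2 * ℓ)) * m := by ring
      _ ≤ (N : ℝ) ^ (ε / 3) * C * m := by gcongr
      _ = (N : ℝ) ^ (ε / 3) * (C * m) := by ring
      _ ≤ (N : ℝ) ^ (ε / 3) * (N : ℝ) ^ ((ℓ : ℝ) + 1 / c - ε) := by gcongr
      _ = R * (N : ℝ) ^ ℓ := by
          rw [hRdef, ← Real.rpow_natCast, ← Real.rpow_add hN0, ← Real.rpow_add hN0]
          congr 1; ring
  set x : ℝ := (1 - ε / 3) * m * Real.logb 2 N with hx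
  set Good := Finset.univ.filter fun S : Fin m → Fin N =>
    (c * empEnt N ℓ (List.ofFn S) + ε / 3 * Real.logb 2 N) * m < ((f S).length : ℝ) with hGood
  have hcardG : Nat.card {S : Fin m → Fin N //
            (c * empEnt N ℓ (List.ofFn S) + ε / 3 * Real.logb 2 N) * m <
              ((f S).length : ℝ)} = Good.card := by
    rw [Nat.card_eq_fintype_card, Fintype.card_subtype]
  rw [hcardG]
  set A := Finset.univ.filter fun S : Fin m → Fin N => ((f S).length : ℝ) ≤ x with hA
  set B := (Finset.univ : Finset (Fin ℓ → Fin N)).biUnion fun α =>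
    Finset.univ.filter fun S : Fin m → Fin N => R < ((occ α S).card : ℝ) with hB
  have hcover : (Finset.univ : Finset (Fin m → Fin N)) ⊆ Good ∪ (A ∪ B) := by
    intro S _
    by_contra hcon
    simp only [Finset.mem_union, not_or] at hcon
    obtain ⟨hG, hSA, hSB⟩ := hcon
    simp only [hGood, hA, hB, Finset.mem_filter, Finset.mem_univ, true_and, not_lt, not_le,
      Finset.mem_biUnion, not_exists] at hG hSA hSB
    have hent := empEnt_le hℓ hmpos S R (by linarith) hSB
    rw [hRdef, Real.logb_rpow_eq_mul_logb_of_pos hN0] at hent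
    have h3 : c * empEnt N ℓ (List.ofFn S) ≤ (1 - 2 * ε / 3) * Real.logb 2 N := by
      calc _ ≤ c * ((1 / c - 2 * ε / 3) * Real.logb 2 N) := by gcongr
        _ = (1 - c * (2 * ε / 3)) * Real.logb 2 N := by field_simp
        _ ≤ _ := by gcongr; nlinarith
    have h4 : (c * empEnt N ℓ (List.ofFn S) + ε / 3 * Real.logb 2 N) * m ≤ x := by
      calc _ ≤ ((1 - 2 * ε / 3) * Real.logb 2 N + ε / 3 * Real.logb 2 N) * m := by gcongr
        _ = x := by rw [hx]; ring
    linarith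
  have hcard : (N : ℝ) ^ m ≤ Good.card + (A.card + B.card) := by
    have := (Finset.card_le_card hcover).trans ((Finset.card_union_le _ _).trans
      (Nat.add_le_add_left (Finset.card_union_le _ _) _))
    rw [Finset.card_univ, Fintype.card_fun, Fintype.card_fin, Fintype.card_fin] at this
    exact_mod_cast this
  have hNm : (0 : ℝ) < (N : ℝ) ^ m := by positivity
  have hAc : (A.card : ℝ) ≤ 2 / (N : ℝ) ^ (ε * m / 3) * (N : ℝ) ^ m := by
    refine (card_short f hf x).trans (le_of_eq ?_)
    have : (2 : ℝ) ^ x = (N : ℝ) ^ ((1 - ε / 3) * m) := by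
      rw [hx, mul_comm, Real.rpow_mul zero_le_two, Real.rpow_logb zero_lt_two (by norm_num) hN0]
    rw [this, ← Real.rpow_natCast, div_mul_eq_mul_div, eq_div_iff (by positivity), mul_assoc,
      ← Real.rpow_add hN0]
    congr 2; ring
  have hBc : (B.card : ℝ) ≤
      (N : ℝ) ^ ℓ / (2 : ℝ) ^ ((N : ℝ) ^ (ε / 3) - ℓ) * (N : ℝ) ^ m := by
    have hb1 : (B.card : ℝ) ≤ ∑ α : Fin ℓ → Fin N,
        ((Finset.univ.filter fun S : Fin m → Fin N => R < ((occ α S).card : ℝ)).card : ℝ) := by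
      exact_mod_cast Finset.card_biUnion_le
    have hb2 : (B.card : ℝ) ≤ ∑ α : Fin ℓ → Fin N, (N : ℝ) ^ m / (2 : ℝ) ^ R :=
      hb1.trans (Finset.sum_le_sum fun α _ => tail_bound hnpos hℓ α R h1 hmR)
    rw [Finset.sum_const, Finset.card_univ, Fintype.card_fun, Fintype.card_fin, Fintype.card_fin,
      nsmul_eq_mul] at hb2
    push_cast at hb2
    have hexp : (N : ℝ) ^ (ε / 3) - ℓ ≤ R := by
      have : (N : ℝ) ^ (ε / 3) ≤ R := Real.rpow_le_rpow_of_exponent_le hN1 (by linarith)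
      linarith
    have h2R : (2 : ℝ) ^ ((N : ℝ) ^ (ε / 3) - ℓ) ≤ (2 : ℝ) ^ R :=
      Real.rpow_le_rpow_of_exponent_le one_le_two hexp
    calc _ ≤ _ := hb2
      _ = (N : ℝ) ^ ℓ / (2 : ℝ) ^ R * (N : ℝ) ^ m := by ring
      _ ≤ _ := by gcongr
  rw [le_div_iff₀ hNm]
  linarith
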